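/- Let d ≥ 3 and let f be a nonzero binary form of degree d. Then f is hyperbolic if and only if for every (v₁, v₂) ∈ ℝ² the directional derivative ∂_v f = v₁·∂f/∂x + v₂·∂f/∂y is either the zero polynomial or a product of d − 1 real linear forms. -/

import Mathlib

open scoped BigOperators
open MvPolynomial

/-- A binary form of degree `d` is hyperbolic if it is a product of `d` real linear forms. -/
def Hyperbolic (d : ℕ) (f : MvPolynomial (Fin 2) ℝ) : Prop :=
  ∃ l : Fin d → ℝ × ℝ, f = ∏ i, (C (l i).1 * X 0 + C (l i).2 * X 1)

open Polynomial in
/-- If `‖β i‖ = ‖α i‖` for all `i`, the coefficients of `q = ∏ (α i + β i X)` satisfy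
`‖q₁² - 2 q₀ q₂‖ ≤ n ‖q₀‖²`, because `q₁² - 2 q₀ q₂ = q₀² ∑ (β i / α i)²`. -/
lemma norm_coeff_prod_linear_le {ι : Type*} (s : Finset ι) (α β : ι → ℂ)
    (h : ∀ i, ‖β i‖ = ‖α i‖) :
    ‖(∏ i ∈ s, (Polynomial.C (α i) + Polynomial.C (β i) * Polynomial.X)).coeff 1 ^ 2 -
      2 * (∏ i ∈ s, (Polynomial.C (α i) + Polynomial.C (β i) * Polynomial.X)).coeff 0 *
        (∏ i ∈ s, (Polynomial.C (α i) + Polynomial.C (β i) * Polynomial.X)).coeff 2‖ ≤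
      s.card * ‖(∏ i ∈ s, (Polynomial.C (α i) + Polynomial.C (β i) * Polynomial.X)).coeff 0‖ ^ 2 := by
  classical
  induction s using Finset.induction_on with
  | empty => simp [Polynomial.coeff_one]
  | insert i s hi ih =>
    rw [Finset.prod_insert hi, Finset.card_insert_of_notMem hi]
    set q := ∏ i ∈ s, (Polynomial.C (α i) + Polynomial.C (β i) * Polynomial.X)
    have h0 : ((Polynomial.C (α i) + Polynomial.C (β i) * Polynomial.X) * q).coeff 0 =
        α i * q.coeff 0 := by
      simp [Polynomial.mul_coeff_zero]
    have h1 : ((Polynomial.C (α i) + Polynomial.C (β i) * Polynomial.X) * q).coeff 1 =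
        α i * q.coeff 1 + β i * q.coeff 0 := by
      rw [add_mul, mul_assoc, Polynomial.coeff_add, Polynomial.coeff_C_mul,
        Polynomial.coeff_C_mul, Polynomial.coeff_X_mul]
    have h2 : ((Polynomial.C (α i) + Polynomial.C (β i) * Polynomial.X) * q).coeff 2 =
        α i * q.coeff 2 + β i * q.coeff 1 := by
      rw [add_mul, mul_assoc, Polynomial.coeff_add, Polynomial.coeff_C_mul,
        Polynomial.coeff_C_mul, Polynomial.coeff_X_mul]
    rw [h0, h1, h2]
    calc _ = ‖α i ^ 2 * (q.coeff 1 ^ 2 - 2 * q.coeff 0 * q.coeff 2) +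
              β i ^ 2 * q.coeff 0 ^ 2‖ := by congr 1; ring
      _ ≤ ‖α i‖ ^ 2 * ‖q.coeff 1 ^ 2 - 2 * q.coeff 0 * q.coeff 2‖ +
            ‖α i‖ ^ 2 * ‖q.coeff 0‖ ^ 2 := by
          refine (norm_add_le _ _).trans ?_
          simp [h i]
      _ ≤ ‖α i‖ ^ 2 * (s.card * ‖q.coeff 0‖ ^ 2) + ‖α i‖ ^ 2 * ‖q.coeff 0‖ ^ 2 := by
          gcongr
      _ = _ := by
          rw [norm_mul]; push_cast; ring

lemma MvPolynomial.IsHomogeneous.eval_mul {σ R : Type*} [CommRing R] [Fintype σ]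
    {f : MvPolynomial σ R} {d : ℕ} (hf : f.IsHomogeneous d) (c : R) (x : σ → R) :
    eval (fun i => c * x i) f = c ^ d * eval x f := by
  rw [eval_eq', eval_eq', Finset.mul_sum]
  refine Finset.sum_congr rfl fun m hm => ?_
  have hdeg : ∑ i, m i = d := by
    rw [← Finsupp.degree_eq_sum]
    by_contra h
    exact (mem_support_iff.1 hm) (hf.coeff_eq_zero h)
  simp only [mul_pow, Finset.prod_mul_distrib, Finset.prod_pow_eq_pow_sum, hdeg]
  ring

lemma eval_dehomogenize (f : MvPolynomial (Fin 2) ℝ) (x : ℝ) :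
    (aeval ![(Polynomial.X : Polynomial ℝ), 1] f).eval x = eval ![x, 1] f := by
  induction f using MvPolynomial.induction_on with
  | C a => simp
  | add p q hp hq => simp [hp, hq]
  | mul_X p i hp => fin_cases i <;> simp [hp]

lemma aeval_dehomogenize (f : MvPolynomial (Fin 2) ℝ) (z : ℂ) :
    Polynomial.aeval z (aeval ![(Polynomial.X : Polynomial ℝ), 1] f) = aeval ![z, 1] f := by
  induction f using MvPolynomial.induction_on with
  | C a => simp
  | add p q hp hq => simp [hp, hq]
  | mul_X p i hp => fin_cases i <;> simp [hp]

lemma natDegree_dehomogenize_le {f : MvPolynomial (Fin 2) ℝ} {d : ℕ} (hf : f.IsHomogeneous d) :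
    (aeval ![(Polynomial.X : Polynomial ℝ), 1] f).natDegree ≤ d := by
  rw [aeval_def, eval₂_eq']
  refine Polynomial.natDegree_sum_le_of_forall_le _ _ fun m hm => ?_
  have hdeg : ∑ i, m i = d := by
    rw [← Finsupp.degree_eq_sum]
    by_contra h
    exact (mem_support_iff.1 hm) (hf.coeff_eq_zero h)
  rw [Fin.sum_univ_two] at hdeg
  simp only [Fin.prod_univ_two, Matrix.cons_val_zero, Matrix.cons_val_one, one_pow, mul_one,
    ← Polynomial.C_eq_algebraMap]
  exact (Polynomial.natDegree_C_mul_X_pow_le _ _).trans (by omega)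

lemma dehomogenize_injective {f g : MvPolynomial (Fin 2) ℝ} {d : ℕ} (hf : f.IsHomogeneous d)
    (hg : g.IsHomogeneous d)
    (h : aeval ![(Polynomial.X : Polynomial ℝ), 1] f = aeval ![Polynomial.X, 1] g) : f = g := by
  refine mul_left_cancel₀ (X_ne_zero (1 : Fin 2)) (MvPolynomial.funext fun x => ?_)
  rcases eq_or_ne (x 1) 0 with hx | hx
  · simp [hx]
  have key : x = fun i => x 1 * (![x 0 / x 1, 1] : Fin 2 → ℝ) i := by
    funext i
    fin_cases i
    · simp; field_simp
    · simp
  rw [map_mul, map_mul]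
  congr 1
  rw [key, hf.eval_mul, hg.eval_mul, ← eval_dehomogenize, h, eval_dehomogenize]

lemma Hyperbolic.isHomogeneous {d : ℕ} {f : MvPolynomial (Fin 2) ℝ} (hf : Hyperbolic d f) :
    f.IsHomogeneous d := by
  obtain ⟨l, rfl⟩ := hf
  simpa using IsHomogeneous.prod Finset.univ
    (fun i => (C (l i).1 * X 0 + C (l i).2 * X 1 : MvPolynomial (Fin 2) ℝ)) (fun _ => 1)
    fun i _ => (isHomogeneous_C_mul_X _ _).add (isHomogeneous_C_mul_X _ _)

lemma hyperbolic_one : Hyperbolic 0 1 := ⟨Fin.elim0, by simp⟩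

lemma Hyperbolic.linear_mul {d : ℕ} {f : MvPolynomial (Fin 2) ℝ} (hf : Hyperbolic d f)
    (a b : ℝ) : Hyperbolic (d + 1) ((C a * X 0 + C b * X 1) * f) := by
  obtain ⟨l, rfl⟩ := hf
  exact ⟨Fin.cons (a, b) l, by simp [Fin.prod_univ_succ]⟩

lemma Hyperbolic.X_one_pow_mul {d : ℕ} {f : MvPolynomial (Fin 2) ℝ} (hf : Hyperbolic d f)
    (k : ℕ) : Hyperbolic (d + k) (X 1 ^ k * f) := by
  induction k with
  | zero => simpa using hf
  | succ k ih =>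
    convert! ih.linear_mul 0 1 using 1
    simp only [C_0, C_1]
    ring

lemma Hyperbolic.C_mul {d : ℕ} (hd : d ≠ 0) {f : MvPolynomial (Fin 2) ℝ} (hf : Hyperbolic d f)
    (c : ℝ) : Hyperbolic d (C c * f) := by
  obtain ⟨n, rfl⟩ := Nat.exists_eq_succ_of_ne_zero hd
  obtain ⟨l, rfl⟩ := hf
  refine ⟨Fin.cons (c * (l 0).1, c * (l 0).2) fun i => l i.succ, ?_⟩
  simp only [Fin.prod_univ_succ, Fin.cons_zero, Fin.cons_succ, MvPolynomial.C_mul]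
  ring

lemma hyperbolic_multiset_prod (m : Multiset ℝ) :
    Hyperbolic m.card (m.map fun r => X 0 - C r * X 1).prod := by
  induction m using Multiset.induction_on with
  | empty => simpa using hyperbolic_one
  | cons r m ih =>
    rw [Multiset.card_cons, Multiset.map_cons, Multiset.prod_cons]
    convert! ih.linear_mul 1 (-r) using 2
    simp only [C_1, C_neg]
    ring

lemma hyperbolic_of_aeval_ne_zero {d : ℕ} (hd : d ≠ 0) {f : MvPolynomial (Fin 2) ℝ}
    (hf : f.IsHomogeneous d) (h : ∀ z : ℂ, z.im ≠ 0 → aeval ![z, 1] f ≠ 0) :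
    Hyperbolic d f := by
  set p := aeval ![(Polynomial.X : Polynomial ℝ), 1] f with hp
  have hsplit : p.Splits := by
    refine Polynomial.Splits.of_splits_map (algebraMap ℝ ℂ) (IsAlgClosed.splits _) fun z hz => ?_
    have hz0 : aeval ![z, 1] f = 0 := by
      rw [← aeval_dehomogenize, ← hp, Polynomial.aeval_def, ← Polynomial.eval_map]
      exact (Polynomial.mem_roots'.1 hz).2
    have him : z.im = 0 := by
      by_contra hne
      exact h z hne hz0
    exact ⟨z.re, Complex.ext (by simp) (by simp [him])⟩
  have hcard : p.roots.card ≤ d := hsplit.natDegree_eq_card_roots ▸ natDegree_dehomogenize_le hf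
  have hyp := ((hyperbolic_multiset_prod p.roots).X_one_pow_mul (d - p.roots.card))
  rw [Nat.add_sub_cancel' hcard] at hyp
  replace hyp := hyp.C_mul hd p.leadingCoeff
  convert! hyp
  refine dehomogenize_injective hf hyp.isHomogeneous ?_
  rw [← hp]
  conv_lhs => rw [hsplit.eq_prod_roots]
  simp [map_multiset_prod, Multiset.map_map, Polynomial.C_eq_algebraMap]

lemma linear_eq_zero_of_aeval_eq_zero {a b : ℝ} {z : ℂ} (hz : z.im ≠ 0)
    (h : (a : ℂ) * z + b = 0) : a = 0 ∧ b = 0 := by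
  have him := congrArg Complex.im h
  have hre := congrArg Complex.re h
  simp only [Complex.add_im, Complex.mul_im, Complex.ofReal_re, Complex.ofReal_im, zero_mul,
    add_zero, Complex.zero_im, mul_eq_zero, hz, or_false] at him
  subst him
  exact ⟨rfl, by simpa using hre⟩

lemma Hyperbolic.eq_zero_of_aeval_eq_zero {d : ℕ} {f : MvPolynomial (Fin 2) ℝ}
    (hf : Hyperbolic d f) {z : ℂ} (hz : z.im ≠ 0) (h : aeval ![z, 1] f = 0) : f = 0 := by
  obtain ⟨l, rfl⟩ := hf
  rw [map_prod, Finset.prod_eq_zero_iff] at h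
  obtain ⟨i, -, hi⟩ := h
  obtain ⟨ha, hb⟩ := linear_eq_zero_of_aeval_eq_zero (a := (l i).1) (b := (l i).2) hz
    (by simpa using hi)
  exact Finset.prod_eq_zero (Finset.mem_univ i) (by simp [ha, hb])

lemma aeval_directional_prod_linear {ι : Type*} (s : Finset ι) (l : ι → ℝ × ℝ) (v : ℝ × ℝ)
    (z : ℂ) (hl : ∀ i ∈ s, ((l i).1 : ℂ) * z + (l i).2 ≠ 0) :
    aeval ![z, 1] ((v.1 • pderiv (0 : Fin 2) + v.2 • pderiv (1 : Fin 2) :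
        Derivation ℝ (MvPolynomial (Fin 2) ℝ) _)
      (∏ i ∈ s, (C (l i).1 * X 0 + C (l i).2 * X 1))) =
    (∏ i ∈ s, (((l i).1 : ℂ) * z + (l i).2)) *
      ∑ i ∈ s, ((l i).1 * v.1 + (l i).2 * v.2 : ℂ) / ((l i).1 * z + (l i).2) := by
  classical
  induction s using Finset.induction_on with
  | empty => simp
  | insert i s hi ih =>
    have hi0 := hl i (Finset.mem_insert_self i s)
    rw [Finset.prod_insert hi, Finset.prod_insert hi, Finset.sum_insert hi, Derivation.leibniz,
      map_add, smul_eq_mul, smul_eq_mul, map_mul, map_mul,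
      ih fun j hj => hl j (Finset.mem_insert_of_mem hj)]
    have h1 : aeval ![z, 1] (C (l i).1 * X 0 + C (l i).2 * X 1 : MvPolynomial (Fin 2) ℝ) =
        ((l i).1 : ℂ) * z + (l i).2 := by simp
    have h2 : aeval ![z, 1] (∏ j ∈ s, (C (l j).1 * X 0 + C (l j).2 * X 1) :
        MvPolynomial (Fin 2) ℝ) = ∏ j ∈ s, (((l j).1 : ℂ) * z + (l j).2) := by
      simp [map_prod]
    have h3 : aeval ![z, 1] ((v.1 • pderiv (0 : Fin 2) + v.2 • pderiv (1 : Fin 2) :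
        Derivation ℝ (MvPolynomial (Fin 2) ℝ) _) (C (l i).1 * X 0 + C (l i).2 * X 1)) =
        ((l i).1 * v.1 + (l i).2 * v.2 : ℂ) := by
      simp [pderiv_X]
      ring
    rw [h1, h2, h3]
    generalize ∑ j ∈ s, ((l j).1 * v.1 + (l j).2 * v.2 : ℂ) / ((l j).1 * z + (l j).2) = t
    field_simp
    ring

lemma Hyperbolic.directional {d : ℕ} (hd : 2 ≤ d) {f : MvPolynomial (Fin 2) ℝ} (hf0 : f ≠ 0)
    (hf : Hyperbolic d f) (v : ℝ × ℝ)
    (hne : v.1 • pderiv (0 : Fin 2) f + v.2 • pderiv (1 : Fin 2) f ≠ 0) :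
    Hyperbolic (d - 1) (v.1 • pderiv (0 : Fin 2) f + v.2 • pderiv (1 : Fin 2) f) := by
  have hhom := hf.isHomogeneous
  refine hyperbolic_of_aeval_ne_zero (by omega) ?_ fun z hz h => ?_
  · simp only [smul_eq_C_mul]
    exact (hhom.pderiv.C_mul _).add (hhom.pderiv.C_mul _)
  obtain ⟨l, rfl⟩ := hf
  have hL : ∀ i, ((l i).1 : ℂ) * z + (l i).2 ≠ 0 := fun i hi => by
    obtain ⟨ha, hb⟩ := linear_eq_zero_of_aeval_eq_zero hz hi
    exact hf0 (Finset.prod_eq_zero (Finset.mem_univ i) (by simp [ha, hb]))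
  have hsum := aeval_directional_prod_linear Finset.univ l v z fun i _ => hL i
  simp only [Derivation.add_apply, Derivation.smul_apply] at hsum
  rw [h, eq_comm, mul_eq_zero, or_iff_right (Finset.prod_ne_zero_iff.2 fun i _ => hL i)] at hsum
  have hsum' := congrArg (starRingEnd ℂ) hsum
  simp only [map_sum, map_div₀, map_add, map_mul, Complex.conj_ofReal, map_zero] at hsum'
  set w := starRingEnd ℂ z with hw
  have hLw : ∀ i, ((l i).1 : ℂ) * w + (l i).2 ≠ 0 := fun i hi => by
    apply hL i
    simpa [hw] using congrArg (starRingEnd ℂ) hi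
  have hident : ∑ i, ((l i).1 * v.1 + (l i).2 * v.2 : ℂ) ^ 2 /
      ((((l i).1 : ℂ) * z + (l i).2) * ((l i).1 * w + (l i).2)) = 0 := by
    have hzw : w - z ≠ 0 := fun h0 => hz (Complex.conj_eq_iff_im.1 (sub_eq_zero.1 h0))
    refine (mul_eq_zero.1 ?_).resolve_left hzw
    calc _ = (v.1 - v.2 * z) * ∑ i, ((l i).1 * v.1 + (l i).2 * v.2 : ℂ) / ((l i).1 * z + (l i).2)
          - (v.1 - v.2 * w) *
            ∑ i, ((l i).1 * v.1 + (l i).2 * v.2 : ℂ) / ((l i).1 * w + (l i).2) := by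
          rw [Finset.mul_sum, Finset.mul_sum, Finset.mul_sum, ← Finset.sum_sub_distrib]
          refine Finset.sum_congr rfl fun i _ => ?_
          have hA := hL i
          have hB := hLw i
          have key : (w - z) * ((l i).1 * v.1 + (l i).2 * v.2 : ℂ) =
              (v.1 - v.2 * z) * ((l i).1 * w + (l i).2) -
                (v.1 - v.2 * w) * ((l i).1 * z + (l i).2) := by ring
          generalize ((l i).1 : ℂ) * z + (l i).2 = A at *
          generalize ((l i).1 : ℂ) * w + (l i).2 = B at *
          generalize ((l i).1 * v.1 + (l i).2 * v.2 : ℂ) = m at *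
          field_simp
          linear_combination m * key
      _ = 0 := by rw [hsum, hsum']; ring
  have hreal : ∑ i, ((l i).1 * v.1 + (l i).2 * v.2) ^ 2 /
      Complex.normSq (((l i).1 : ℂ) * z + (l i).2) = 0 := by
    rw [← Complex.ofReal_inj, ← hident.trans Complex.ofReal_zero.symm]
    push_cast
    refine Finset.sum_congr rfl fun i _ => ?_
    rw [← Complex.mul_conj]
    simp [hw]
  rw [Finset.sum_eq_zero_iff_of_nonneg fun i _ =>
    div_nonneg (sq_nonneg _) (Complex.normSq_nonneg _)] at hreal
  have hzero : ∀ i, (l i).1 * v.1 + (l i).2 * v.2 = 0 := fun i => by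
    have := hreal i (Finset.mem_univ i)
    rw [div_eq_zero_iff, or_iff_left (by simpa using hL i)] at this
    exact pow_eq_zero_iff two_ne_zero |>.1 this
  apply hne
  have hD : ∀ s : Finset (Fin d), (v.1 • pderiv (0 : Fin 2) + v.2 • pderiv (1 : Fin 2) :
      Derivation ℝ (MvPolynomial (Fin 2) ℝ) _)
      (∏ i ∈ s, (C (l i).1 * X 0 + C (l i).2 * X 1)) = 0 := fun s => by
    induction s using Finset.induction_on with
    | empty => simp
    | insert i s hi ih =>
      rw [Finset.prod_insert hi, Derivation.leibniz, ih]
      have : (v.1 • pderiv (0 : Fin 2) + v.2 • pderiv (1 : Fin 2) :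
          Derivation ℝ (MvPolynomial (Fin 2) ℝ) _) (C (l i).1 * X 0 + C (l i).2 * X 1) =
          C ((l i).1 * v.1 + (l i).2 * v.2) := by
        simp [pderiv_X, smul_eq_C_mul]
        ring
      rw [this, hzero i]
      simp
  simpa using hD Finset.univ

open Polynomial in
lemma derivative_aeval_pair (x y : ℂ[X]) (f : MvPolynomial (Fin 2) ℝ) :
    derivative (MvPolynomial.aeval ![x, y] f) =
      derivative x * MvPolynomial.aeval ![x, y] (pderiv 0 f) +
      derivative y * MvPolynomial.aeval ![x, y] (pderiv 1 f) := by
  induction f using MvPolynomial.induction_on with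
  | C a => simp [IsScalarTower.algebraMap_apply ℝ ℂ ℂ[X]]
  | add p q hp hq => simp only [map_add, hp, hq]; ring
  | mul_X p i hp =>
    fin_cases i <;>
      simp [hp, pderiv_X, Derivation.leibniz] <;> ring

lemma eq_zero_of_pderiv_eq_zero {d : ℕ} (hd : d ≠ 0) {f : MvPolynomial (Fin 2) ℝ}
    (hf : f.IsHomogeneous d) (h0 : pderiv 0 f = 0) (h1 : pderiv 1 f = 0) : f = 0 := by
  have := hf.sum_X_mul_pderiv
  simpa [Fin.sum_univ_two, h0, h1, hd] using this.symm

open Polynomial in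
/-- A coefficient bound for the restriction of a hyperbolic form to the complex line
`t ↦ (z, 1) + t (z̄, 1)`. -/
lemma Hyperbolic.norm_coeff_le {n : ℕ} {h : MvPolynomial (Fin 2) ℝ} (hh : Hyperbolic n h) (z : ℂ)
    {q : ℂ[X]} (hq : q = MvPolynomial.aeval
      ![Polynomial.C z + Polynomial.C (starRingEnd ℂ z) * Polynomial.X, 1 + Polynomial.X] h) :
    ‖q.coeff 1 ^ 2 - 2 * q.coeff 0 * q.coeff 2‖ ≤ n * ‖q.coeff 0‖ ^ 2 := by
  obtain ⟨l, rfl⟩ := hh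
  have hprod : q = ∏ i, (Polynomial.C (((l i).1 : ℂ) * z + (l i).2) +
      Polynomial.C (((l i).1 : ℂ) * starRingEnd ℂ z + (l i).2) * Polynomial.X) := by
    rw [hq, map_prod]
    refine Finset.prod_congr rfl fun i _ => ?_
    simp [IsScalarTower.algebraMap_apply ℝ ℂ ℂ[X]]
    ring
  rw [hprod]
  simpa using norm_coeff_prod_linear_le Finset.univ (fun i => ((l i).1 : ℂ) * z + (l i).2)
    (fun i => ((l i).1 : ℂ) * starRingEnd ℂ z + (l i).2) fun i => by
      rw [← Complex.norm_conj]; simp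

lemma norm_quadratic_bound {a A B : ℂ} {M : ℝ}
    (h : ∀ u : ℂ, ‖u ^ 2 * a + u * starRingEnd ℂ u * A + starRingEnd ℂ u ^ 2 * B‖ ≤ M * ‖u‖ ^ 2) :
    ‖a‖ ≤ M := by
  have h1 := h 1
  have h2 := h Complex.I
  have h3 := h (1 + Complex.I)
  have h4 := h (1 - Complex.I)
  have n3 : ‖1 + Complex.I‖ ^ 2 = 2 := by
    rw [← Complex.normSq_eq_norm_sq]; norm_num [Complex.normSq_apply]
  have n4 : ‖1 - Complex.I‖ ^ 2 = 2 := by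
    rw [← Complex.normSq_eq_norm_sq]; norm_num [Complex.normSq_apply]
  rw [n3] at h3
  rw [n4] at h4
  simp only [map_one, norm_one, Complex.norm_I, map_add, map_sub, Complex.conj_I] at h1 h2 h3 h4
  set N1 := (1 : ℂ) ^ 2 * a + 1 * 1 * A + 1 ^ 2 * B with hN1
  set N2 := Complex.I ^ 2 * a + Complex.I * -Complex.I * A + (-Complex.I) ^ 2 * B with hN2
  set N3 := (1 + Complex.I) ^ 2 * a + (1 + Complex.I) * (1 + -Complex.I) * A +
    (1 + -Complex.I) ^ 2 * B with hN3
  set N4 := (1 - Complex.I) ^ 2 * a + (1 - Complex.I) * (1 - -Complex.I) * A +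
    (1 - -Complex.I) ^ 2 * B with hN4
  have hcomb : 8 * a = 2 * N1 - 2 * N2 - Complex.I * N3 + Complex.I * N4 := by
    rw [hN1, hN2, hN3, hN4]
    linear_combination (6 * a - 2 * B - 2 * A) * Complex.I_sq
  have hnorm : ‖8 * a‖ ≤ 2 * ‖N1‖ + 2 * ‖N2‖ + ‖N3‖ + ‖N4‖ := by
    rw [hcomb]
    refine (norm_add_le _ _).trans (add_le_add ((norm_sub_le _ _).trans
      (add_le_add ((norm_sub_le _ _).trans ?_) ?_)) ?_) <;> simp
  rw [norm_mul, Complex.norm_ofNat] at hnorm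
  linarith

open Polynomial in
lemma aeval_ne_zero_of_directional_hyperbolic {d : ℕ} (hd : 3 ≤ d) {f : MvPolynomial (Fin 2) ℝ}
    (hf0 : f ≠ 0) (hf : f.IsHomogeneous d)
    (H : ∀ v : ℝ × ℝ, v.1 • pderiv (0 : Fin 2) f + v.2 • pderiv (1 : Fin 2) f = 0 ∨
      Hyperbolic (d - 1) (v.1 • pderiv (0 : Fin 2) f + v.2 • pderiv (1 : Fin 2) f))
    {z : ℂ} (hz : z.im ≠ 0) : MvPolynomial.aeval ![z, 1] f ≠ 0 := by
  intro hfz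
  set w := starRingEnd ℂ z with hw
  set φ := MvPolynomial.aeval (R := ℝ)
    ![Polynomial.C z + Polynomial.C w * Polynomial.X, (1 + Polynomial.X : ℂ[X])] with hφ
  have hcoeff0 : ∀ g, (φ g).coeff 0 = MvPolynomial.aeval ![z, 1] g := fun g => by
    induction g using MvPolynomial.induction_on with
    | C a => simp [hφ, IsScalarTower.algebraMap_apply ℝ ℂ ℂ[X]]
    | add p q hp hq => simp [hp, hq]
    | mul_X p i hp => fin_cases i <;> simp [hφ, Polynomial.mul_coeff_zero] <;> simp [← hp, hφ]
  set P := φ (pderiv 0 f) with hP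
  set Q := φ (pderiv 1 f) with hQ
  set G := φ f with hG
  have hder : derivative G = Polynomial.C w * P + Q := by
    rw [hG, hφ, derivative_aeval_pair]
    simp [hP, hQ, hφ]
  have heuler : (d : ℂ[X]) * G = Polynomial.C z * P + Q + Polynomial.X * derivative G := by
    have := congrArg φ hf.sum_X_mul_pderiv
    rw [Fin.sum_univ_two, map_add, map_mul, map_mul, map_nsmul, nsmul_eq_mul] at this
    rw [← hG, ← hP, ← hQ] at this
    rw [← this, hder]
    simp [hφ]
    ring
  have hG0 : G.coeff 0 = 0 := by rw [hG, hcoeff0, hfz]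
  have hG1 : (derivative G).coeff 0 = G.coeff 1 := by simp [Polynomial.coeff_derivative]
  have hG2 : (derivative G).coeff 1 = 2 * G.coeff 2 := by simp [Polynomial.coeff_derivative]; ring
  have hG3 : (derivative G).coeff 2 = 3 * G.coeff 3 := by simp [Polynomial.coeff_derivative]; ring
  have hcast : (d : ℂ[X]) = Polynomial.C (d : ℂ) := by simp
  rw [hcast] at heuler
  set S := Polynomial.C z * P + Q with hS
  have hS0 : S.coeff 0 = 0 := by
    have := congrArg (fun p : ℂ[X] => p.coeff 0) heuler
    simpa [hG0] using this.symm
  have hS1 : S.coeff 1 = (d - 1) * G.coeff 1 := by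
    have := congrArg (fun p : ℂ[X] => p.coeff 1) heuler
    simp only [Polynomial.coeff_C_mul, Polynomial.coeff_add, Polynomial.coeff_X_mul, hG1] at this
    linear_combination -this
  have hS2 : S.coeff 2 = (d - 2) * G.coeff 2 := by
    have := congrArg (fun p : ℂ[X] => p.coeff 2) heuler
    simp only [Polynomial.coeff_C_mul, Polynomial.coeff_add, Polynomial.coeff_X_mul, hG2] at this
    linear_combination -this
  have hg1 : G.coeff 1 ≠ 0 := fun hg => by
    rw [← hG1, hder] at hg
    rw [hS] at hS0
    simp only [Polynomial.coeff_add, Polynomial.coeff_C_mul] at hg hS0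
    have hzw : w - z ≠ 0 := fun h0 => hz (Complex.conj_eq_iff_im.1 (sub_eq_zero.1 h0))
    have hP0 : P.coeff 0 = 0 := (mul_eq_zero.1 (by linear_combination hg - hS0 :
      (w - z) * P.coeff 0 = 0)).resolve_left hzw
    have hQ0 : Q.coeff 0 = 0 := by simpa [hP0] using hS0
    rw [hP, hcoeff0] at hP0
    rw [hQ, hcoeff0] at hQ0
    have h0 : pderiv 0 f = 0 := by
      rcases H (1, 0) with h | h
      · simpa using h
      · exact Hyperbolic.eq_zero_of_aeval_eq_zero (by simpa using h) hz hP0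
    have h1 : pderiv 1 f = 0 := by
      rcases H (0, 1) with h | h
      · simpa using h
      · exact Hyperbolic.eq_zero_of_aeval_eq_zero (by simpa using h) hz hQ0
    exact hf0 (eq_zero_of_pderiv_eq_zero (by omega) hf h0 h1)
  have hbound : ∀ u : ℂ, ‖u ^ 2 * ((d - 1) * G.coeff 1) ^ 2 + u * starRingEnd ℂ u *
      (4 * (d - 1) * G.coeff 1 * G.coeff 2 - 2 * (d - 2) * G.coeff 1 * G.coeff 2) +
      starRingEnd ℂ u ^ 2 * (4 * G.coeff 2 ^ 2 - 6 * G.coeff 1 * G.coeff 3)‖ ≤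
      ((d - 1 : ℕ) * ‖G.coeff 1‖ ^ 2) * ‖u‖ ^ 2 := fun u => by
    let v : ℝ × ℝ := (2 * (u * z).re, 2 * u.re)
    have hv1 : (v.1 : ℂ) = u * z + starRingEnd ℂ u * w := by
      rw [hw, ← map_mul, Complex.add_conj]
    have hv2 : (v.2 : ℂ) = u + starRingEnd ℂ u := by
      rw [Complex.add_conj]
    have hq : φ (v.1 • pderiv (0 : Fin 2) f + v.2 • pderiv (1 : Fin 2) f) =
        Polynomial.C u * S + Polynomial.C (starRingEnd ℂ u) * derivative G := by
      have hsmul : ∀ (r : ℝ) (p : ℂ[X]), r • p = Polynomial.C (r : ℂ) * p := fun r p => by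
        rw [Algebra.smul_def, IsScalarTower.algebraMap_apply ℝ ℂ ℂ[X],
          ← Polynomial.C_eq_algebraMap]
        rfl
      rw [map_add, map_smul, map_smul, hsmul, hsmul, hv1, hv2, ← hP, ← hQ, hder, hS]
      simp only [map_add, map_mul]
      ring
    have hle : ‖(φ (v.1 • pderiv (0 : Fin 2) f + v.2 • pderiv (1 : Fin 2) f)).coeff 1 ^ 2 -
        2 * (φ (v.1 • pderiv (0 : Fin 2) f + v.2 • pderiv (1 : Fin 2) f)).coeff 0 *
        (φ (v.1 • pderiv (0 : Fin 2) f + v.2 • pderiv (1 : Fin 2) f)).coeff 2‖ ≤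
        (d - 1 : ℕ) *
          ‖(φ (v.1 • pderiv (0 : Fin 2) f + v.2 • pderiv (1 : Fin 2) f)).coeff 0‖ ^ 2 := by
      rcases H v with h | h
      · simp [h]
      · exact h.norm_coeff_le z rfl
    rw [hq] at hle
    simp only [Polynomial.coeff_add, Polynomial.coeff_C_mul, hS0, hS1, hS2, hG1, hG2, hG3,
      mul_zero, zero_add] at hle
    rw [norm_mul, Complex.norm_conj] at hle
    convert! hle using 1
    · congr 1
      ring
    · ring
  have hfin := norm_quadratic_bound hbound
  have hd1 : ((d : ℂ) - 1) = ((d - 1 : ℕ) : ℂ) := by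
    rw [Nat.cast_sub (by omega), Nat.cast_one]
  rw [hd1, norm_pow, norm_mul, Complex.norm_natCast] at hfin
  have hpos : 0 < ‖G.coeff 1‖ ^ 2 := by positivity
  have hn : (2 : ℝ) ≤ (d - 1 : ℕ) := by exact_mod_cast (by omega : 2 ≤ d - 1)
  nlinarith [mul_pos hpos (by linarith : (0 : ℝ) < (d - 1 : ℕ)),
    mul_le_mul_of_nonneg_right hn (mul_pos hpos (by linarith : (0 : ℝ) < (d - 1 : ℕ))).le]

/-- A nonzero binary form `f` of degree `d ≥ 3` is hyperbolic if and only if every directional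
derivative `∂_v f = v₁ ∂f/∂x + v₂ ∂f/∂y` is zero or a product of `d - 1` real linear forms. -/
theorem statement10 (d : ℕ) (hd : 3 ≤ d) (f : MvPolynomial (Fin 2) ℝ)
    (hf0 : f ≠ 0) (hfhom : f.IsHomogeneous d) :
    Hyperbolic d f ↔ ∀ v : ℝ × ℝ,
      v.1 • pderiv (0 : Fin 2) f + v.2 • pderiv (1 : Fin 2) f = 0 ∨
      Hyperbolic (d - 1) (v.1 • pderiv (0 : Fin 2) f + v.2 • pderiv (1 : Fin 2) f) :=
  ⟨fun h v => or_iff_not_imp_left.2 (h.directional (by omega) hf0 v),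
    fun H => hyperbolic_of_aeval_ne_zero (by omega) hfhom fun _ hz =>
      aeval_ne_zero_of_directional_hyperbolic hd hf0 hfhom H hz⟩
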